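/- Let Q : g → g be ad-equivariant and homogeneous of degree m ≥ 1, and let h, e ∈ g satisfy [h, e] = 2e. Set y = dQ(e).h. Then [e, y] = −2m·Q(e). -/

import Mathlib

/-- Euler's identity for homogeneous maps. -/
theorem fderiv_apply_self_of_homogeneous {E F : Type*} [NormedAddCommGroup E] [NormedSpace ℂ E]
    [NormedAddCommGroup F] [NormedSpace ℂ F] {Q : E → F} {m : ℕ} {x : E}
    (hQ : DifferentiableAt ℂ Q x) (hhom : ∀ t : ℂ, Q (t • x) = t ^ m • Q x) :
    fderiv ℂ Q x x = (m : ℂ) • Q x := by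
  have hline : HasDerivAt (fun t : ℂ => t • x) x 1 := by
    simpa using (hasDerivAt_id (1 : ℂ)).smul_const x
  have hcomp : HasDerivAt (fun t : ℂ => Q (t • x)) (fderiv ℂ Q x x) 1 :=
    HasFDerivAt.comp_hasDerivAt (l := Q) 1 (by simpa using hQ.hasFDerivAt) hline
  have hpow : HasDerivAt (fun t : ℂ => t ^ m • Q x) ((m : ℂ) • Q x) 1 := by
    simpa using (hasDerivAt_pow m (1 : ℂ)).smul_const (Q x)
  simp only [hhom] at hcomp
  exact hcomp.unique hpow

/-- Differentiating the identity `B x (Q x) = 0` at `x` in the direction `v`. -/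
theorem bilin_apply_fderiv_of_bilin_self_eq_zero {E F G : Type*}
    [NormedAddCommGroup E] [NormedSpace ℂ E]
    [NormedAddCommGroup F] [NormedSpace ℂ F] [FiniteDimensional ℂ F]
    [NormedAddCommGroup G] [NormedSpace ℂ G]
    (B : E →ₗ[ℂ] F →ₗ[ℂ] G) {Q : E → F} (hB : ∀ x, B x (Q x) = 0) {x : E}
    (hQ : DifferentiableAt ℂ Q x) (v : E) :
    B x (fderiv ℂ Q x v) = -B v (Q x) := by
  have hline : HasDerivAt (fun t : ℂ => x + t • v) v 0 := by
    simpa using ((hasDerivAt_id (0 : ℂ)).smul_const v).const_add x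
  have hcomp : HasDerivAt (fun t : ℂ => Q (x + t • v)) (fderiv ℂ Q x v) 0 :=
    HasFDerivAt.comp_hasDerivAt (l := Q) 0 (by simpa using hQ.hasFDerivAt) hline
  have hB' (y : E) : HasDerivAt (fun t : ℂ => B y (Q (x + t • v))) (B y (fderiv ℂ Q x v)) 0 :=
    (LinearMap.toContinuousLinearMap (B y)).hasFDerivAt.comp_hasDerivAt 0 hcomp
  have hsum : HasDerivAt (fun t : ℂ => B x (Q (x + t • v)) + t • B v (Q (x + t • v)))
      (B x (fderiv ℂ Q x v) + B v (Q x)) 0 := by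
    refine ((hB' x).add ((hasDerivAt_id (0 : ℂ)).smul (hB' v))).congr_deriv ?_
    simp
  have hzero (t : ℂ) : B x (Q (x + t • v)) + t • B v (Q (x + t • v)) = 0 := by
    simpa using hB (x + t • v)
  simp only [hzero] at hsum
  exact eq_neg_of_add_eq_zero_left (hsum.unique (hasDerivAt_const 0 0))

theorem stmt {g : Type*} [NormedAddCommGroup g] [NormedSpace ℂ g] [FiniteDimensional ℂ g]
    -- `lie` is the Lie bracket of the finite-dimensional complex Lie algebra `g`,
    -- given as bilinear data so that it is compatible with the normed space structure.
    (lie : g →ₗ[ℂ] g →ₗ[ℂ] g)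
    (lie_self : ∀ x : g, lie x x = 0)
    (lie_jacobi : ∀ x y z : g, lie x (lie y z) = lie (lie x y) z + lie y (lie x z))
    (Q : g → g) (hQ : ContDiff ℂ ⊤ Q)
    (hQeq : ∀ x y : g, fderiv ℂ Q x (lie y x) = lie y (Q x))
    (m : ℕ) (hm : 1 ≤ m)
    (hhom : ∀ (t : ℂ) (x : g), Q (t • x) = t ^ m • Q x)
    (h e : g) (hhe : lie h e = (2 : ℂ) • e) :
    lie e (fderiv ℂ Q e h) = (-(2 * (m : ℂ))) • Q e := by
  have hdiff : DifferentiableAt ℂ Q e := (hQ.differentiable (by simp)).differentiableAt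
  have hcomm (x : g) : lie x (Q x) = 0 := by rw [← hQeq, lie_self, map_zero]
  rw [bilin_apply_fderiv_of_bilin_self_eq_zero lie hcomm hdiff, ← hQeq, hhe, map_smul,
    fderiv_apply_self_of_homogeneous hdiff fun t => hhom t e, smul_smul, neg_smul]
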